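/- Let K and L be solid cones in V and D : K → L a mapping that is homogeneous of degree 1 and superadditive (equivalently, concave): D(x + y) ≥_L D(x) + D(y) for all x, y ∈ K. Then D is completely monotone if and only if both of the following hold: (M1) D(h) ≠ 0 for every nonzero h ∈ K, and (M4) D(h*) ∈ L° for some h* ∈ K. -/

import Mathlib

open MeasureTheory Filter Topology
open scoped ENNReal Classical

noncomputable section

/-- A cone: a set containing all nonnegative linear combinations of its elements. -/
def IsCone {E : Type*} [AddCommGroup E] [Module ℝ E] (K : Set E) : Prop :=
  ∀ x ∈ K, ∀ y ∈ K, ∀ a b : ℝ, 0 ≤ a → 0 ≤ b → a • x + b • y ∈ K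

/-- A solid cone: a closed proper cone with nonempty interior. -/
def IsSolidCone {E : Type*} [NormedAddCommGroup E] [NormedSpace ℝ E] (K : Set E) : Prop :=
  IsCone K ∧ IsClosed K ∧ K ∩ (-K) = {0} ∧ (interior K).Nonempty

/-- `x ≤_K y` iff `y - x ∈ K`. -/
def coneLE {E : Type*} [AddCommGroup E] (K : Set E) (x y : E) : Prop := y - x ∈ K

/-- `x ≺_K y` iff `x ≤_K y` and `x ≠ y`. -/
def conePrec {E : Type*} [AddCommGroup E] (K : Set E) (x y : E) : Prop :=
  coneLE K x y ∧ x ≠ y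

/-- `x <_K y` iff `y - x ∈ K°`. -/
def coneLT {E : Type*} [NormedAddCommGroup E] (K : Set E) (x y : E) : Prop :=
  y - x ∈ interior K

/-- A map `D : K → L` is completely monotone if it preserves each of the three
order relations `≤_K`, `≺_K`, `<_K`. -/
def CompletelyMonotoneOn {E : Type*} [NormedAddCommGroup E] (K L : Set E) (D : E → E) : Prop :=
  (∀ x ∈ K, ∀ y ∈ K, coneLE K x y → coneLE L (D x) (D y)) ∧
  (∀ x ∈ K, ∀ y ∈ K, conePrec K x y → conePrec L (D x) (D y)) ∧
  (∀ x ∈ K, ∀ y ∈ K, coneLT K x y → coneLT L (D x) (D y))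

/-- A map `D : K → L` is strictly monotone if `x ≺_K y` implies `D x <_L D y`. -/
def ConeStrictlyMonotoneOn {E : Type*} [NormedAddCommGroup E] (K L : Set E) (D : E → E) : Prop :=
  ∀ x ∈ K, ∀ y ∈ K, conePrec K x y → coneLT L (D x) (D y)

/-- The dual cone `K* = {φ : φ(x) ≥ 0 for all x ∈ K}`. -/
def dualCone {E : Type*} [NormedAddCommGroup E] [NormedSpace ℝ E] (K : Set E) :
    Set (E →L[ℝ] ℝ) := {φ | ∀ x ∈ K, 0 ≤ φ x}

theorem IsCone.add_mem {E : Type*} [AddCommGroup E] [Module ℝ E] {K : Set E} (hK : IsCone K)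
    {x y : E} (hx : x ∈ K) (hy : y ∈ K) : x + y ∈ K := by
  simpa using hK x hx y hy 1 1 zero_le_one zero_le_one

theorem IsCone.smul_mem {E : Type*} [AddCommGroup E] [Module ℝ E] {K : Set E} (hK : IsCone K)
    {x : E} (hx : x ∈ K) {a : ℝ} (ha : 0 ≤ a) : a • x ∈ K := by
  simpa using hK x hx x hx a 0 ha le_rfl

theorem IsCone.add_mem_interior {E : Type*} [NormedAddCommGroup E] [NormedSpace ℝ E]
    {K : Set E} (hK : IsCone K) {x y : E} (hx : x ∈ interior K) (hy : y ∈ K) :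
    x + y ∈ interior K := by
  have hsub : (fun z => z + y) '' interior K ⊆ interior K := by
    refine interior_maximal ?_ ((Homeomorph.addRight y).isOpenMap _ isOpen_interior)
    rintro _ ⟨z, hz, rfl⟩
    exact hK.add_mem (interior_subset hz) hy
  exact hsub ⟨x, hx, rfl⟩

theorem IsCone.smul_mem_interior {E : Type*} [NormedAddCommGroup E] [NormedSpace ℝ E]
    {K : Set E} (hK : IsCone K) {x : E} (hx : x ∈ interior K) {a : ℝ} (ha : 0 < a) :
    a • x ∈ interior K := by
  have hsub : (fun z => a • z) '' interior K ⊆ interior K := by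
    refine interior_maximal ?_ (isOpenMap_smul₀ ha.ne' _ isOpen_interior)
    rintro _ ⟨z, hz, rfl⟩
    exact hK.smul_mem (interior_subset hz) ha.le
  exact hsub ⟨x, hx, rfl⟩

theorem exists_pos_sub_smul_mem {E : Type*} [NormedAddCommGroup E] [NormedSpace ℝ E]
    {K : Set E} {x : E} (hx : x ∈ interior K) (h : E) : ∃ a : ℝ, 0 < a ∧ x - a • h ∈ K := by
  have hcont : ContinuousAt (fun a : ℝ => x - a • h) 0 := by fun_prop
  have hev : ∀ᶠ a : ℝ in 𝓝 0, x - a • h ∈ K :=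
    hcont.eventually (by simpa using mem_interior_iff_mem_nhds.1 hx)
  have hev' : ∀ᶠ a : ℝ in 𝓝[>] 0, 0 < a ∧ x - a • h ∈ K :=
    eventually_mem_nhdsWithin.and (hev.filter_mono nhdsWithin_le_nhds)
  exact hev'.exists

/-- **Complete monotonicity criterion for concave homogeneous maps.** If `D : K → L` is
homogeneous of degree one and superadditive (equivalently concave), then `D` is
completely monotone iff (M1): `D h ≠ 0` for every nonzero `h ∈ K`, and (M4):
`D h* ∈ L°` for some `h* ∈ K`. -/
theorem superadditive_homogeneous_completelyMonotone_iff
    {E : Type*} [NormedAddCommGroup E] [NormedSpace ℝ E] [FiniteDimensional ℝ E]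
    (K L : Set E) (hK : IsSolidCone K) (hL : IsSolidCone L)
    (D : E → E) (hDmaps : ∀ x ∈ K, D x ∈ L)
    (hDhom : ∀ l : ℝ, 0 < l → ∀ x ∈ K, D (l • x) = l • D x)
    (hDsuper : ∀ x ∈ K, ∀ y ∈ K, coneLE L (D x + D y) (D (x + y))) :
    CompletelyMonotoneOn K L D ↔
      ((∀ h ∈ K, h ≠ 0 → D h ≠ 0) ∧ ∃ h ∈ K, D h ∈ interior L) := by
  obtain ⟨hKc, -, hKp, hKi⟩ := hK
  obtain ⟨hLc, -, hLp, -⟩ := hL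
  have h0 : (0 : E) ∈ K := (hKp.ge rfl).1
  have hD0 : D 0 = 0 := by
    have h2 : D 0 = D 0 + D 0 := by simpa [two_smul] using hDhom 2 two_pos 0 h0
    simpa using h2
  constructor
  · rintro ⟨-, hprec, hlt⟩
    refine ⟨fun h hh hne hD => ?_, ?_⟩
    · exact (hprec 0 h0 h hh ⟨by simpa [coneLE] using hh, hne.symm⟩).2 (hD0.trans hD.symm)
    · obtain ⟨h, hh⟩ := hKi
      refine ⟨h, interior_subset hh, ?_⟩
      simpa [coneLT, hD0] using hlt 0 h0 h (interior_subset hh) (by simpa [coneLT] using hh)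
  · rintro ⟨hne, h, hh, hDh⟩
    have hsub : ∀ x ∈ K, ∀ y, y - x ∈ K → D y - D x - D (y - x) ∈ L := fun x hx y hxy => by
      simpa [coneLE, sub_sub] using hDsuper x hx (y - x) hxy
    have hmono : ∀ x ∈ K, ∀ y ∈ K, coneLE K x y → coneLE L (D x) (D y) := fun x hx y _ hxy => by
      simpa [coneLE] using hLc.add_mem (hsub x hx y hxy) (hDmaps _ hxy)
    refine ⟨hmono, fun x hx y hy hxy => ⟨hmono x hx y hy hxy.1, fun heq => ?_⟩,
      fun x hx y _ hxy => ?_⟩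
    · have hneg : -D (y - x) ∈ L := by simpa [heq] using hsub x hx y hxy.1
      have hzero : D (y - x) ∈ ({0} : Set E) := hLp.le ⟨hDmaps _ hxy.1, hneg⟩
      exact hne _ hxy.1 (sub_ne_zero.2 hxy.2.symm) hzero
    · obtain ⟨a, ha, hmem⟩ := exists_pos_sub_smul_mem hxy h
      have hle := hsub _ (hKc.smul_mem hh ha.le) (y - x) hmem
      rw [hDhom a ha h hh] at hle
      have hrest := hLc.add_mem (hLc.add_mem hle (hDmaps _ hmem))
        (hsub x hx y (interior_subset hxy))
      have hint := hLc.add_mem_interior (hLc.smul_mem_interior hDh ha) hrest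
      unfold coneLT
      convert hint using 1
      abel
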